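/- Let F and G be non-zero polynomials in ℂ[z, w] satisfying F(z, w) = F̄(w, z) and G(z, w) = Ḡ(w, z), where F̄ denotes the polynomial obtained from F by conjugating all coefficients. Let deg_z F = m and deg_z G = n. Then the set {z ∈ ℂ : F(z, z̄) = 0 and G(z, z̄) = 0} is either infinite or has at most 2·m·n elements. -/

import Mathlib

open MvPolynomial

theorem Polynomial.resultant_ne_zero_of_isRelPrime {R : Type*} [CommRing R] [IsDomain R]
    [UniqueFactorizationMonoid R] {f g : Polynomial R} (hf : f ≠ 0) (hfg : IsRelPrime f g) :
    f.resultant g ≠ 0 := by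
  intro h
  obtain ⟨v, hv, hv0⟩ := Matrix.exists_mulVec_eq_zero_iff.mpr h
  rw [← Polynomial.toMatrix_sylvesterMap' f g le_rfl le_rfl] at hv0
  set b := ((degreeLT.basis R f.natDegree).prod
    (degreeLT.basis R g.natDegree)).reindex finSumFinEquiv with hb
  obtain ⟨x, rfl⟩ : ∃ x, v = b.repr x := ⟨b.repr.symm (Finsupp.equivFunOnFinite.symm v), by simp⟩
  rw [LinearMap.toMatrix_mulVec_repr] at hv0
  have hx : sylvesterMap f g le_rfl le_rfl x = 0 :=
    (degreeLT.basis R (f.natDegree + g.natDegree)).repr.map_eq_zero_iff.mp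
      (DFunLike.coe_injective (hv0.trans rfl))
  obtain ⟨⟨p, hp⟩, ⟨q, hq⟩⟩ := x
  have hx' : f * q + g * p = 0 := congrArg Subtype.val hx
  have hdvd : f ∣ p := hfg.dvd_of_dvd_mul_left ⟨-q, by linear_combination hx'⟩
  have hp0 : p = 0 := by
    refine Polynomial.eq_zero_of_dvd_of_degree_lt hdvd ?_
    rw [Polynomial.degree_eq_natDegree hf]
    exact Polynomial.mem_degreeLT.mp hp
  have hq0 : q = 0 := by
    rw [hp0, mul_zero, add_zero] at hx'
    exact (mul_eq_zero.mp hx').resolve_left hf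
  apply hv
  subst hp0 hq0
  have hzero : ((⟨0, hp⟩, ⟨0, hq⟩) :
      Polynomial.degreeLT R f.natDegree × Polynomial.degreeLT R g.natDegree) = 0 := rfl
  simp [hzero]

theorem MvPolynomial.degreeOf_resultant_le {σ R : Type*} [CommRing R] (i : σ)
    (f g : Polynomial (MvPolynomial σ R)) {m n b d : ℕ}
    (hf : ∀ k, (f.coeff k).degreeOf i ≤ b) (hg : ∀ k, (g.coeff k).degreeOf i ≤ d) :
    (f.resultant g m n).degreeOf i ≤ m * d + n * b := by
  rw [Polynomial.resultant, Matrix.det_apply]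
  refine (degreeOf_sum_le _ _ _).trans (Finset.sup_le fun τ _ => ?_)
  have hs : ∀ p : MvPolynomial σ R, (Equiv.Perm.sign τ • p).degreeOf i = p.degreeOf i := by
    intro p
    rcases Int.units_eq_one_or (Equiv.Perm.sign τ) with h | h <;> simp [h, degreeOf_neg]
  rw [hs]
  refine (degreeOf_prod_le _ _ _).trans ?_
  calc _ ≤ ∑ j : Fin (m + n), Fin.addCases (motive := fun _ => ℕ) (fun _ => d) (fun _ => b) j := by
        refine Finset.sum_le_sum fun j _ => ?_
        induction j using Fin.addCases with
        | left j =>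
          simp only [Polynomial.sylvester, Matrix.of_apply, Fin.addCases_left]
          split_ifs <;> simp [hg]
        | right j =>
          simp only [Polynomial.sylvester, Matrix.of_apply, Fin.addCases_right]
          split_ifs <;> simp [hf]
    _ = _ := by simp [Fin.sum_univ_add]

theorem MvPolynomial.ncard_zeros_le_degreeOf {K : Type*} [Field K]
    {r : MvPolynomial (Fin 1) K} (hr : r ≠ 0) :
    {w : K | eval ![w] r = 0}.Finite ∧ {w : K | eval ![w] r = 0}.ncard ≤ r.degreeOf 0 := by
  classical
  set p : Polynomial K := (finSuccEquiv K 0 r).map (eval ![]) with hp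
  have hinj : Function.Injective (eval (![] : Fin 0 → K)) := by
    intro x y h
    rw [eq_C_of_isEmpty x, eq_C_of_isEmpty y] at h ⊢
    simpa using h
  have hp0 : p ≠ 0 := by
    rw [hp, Polynomial.map_ne_zero_iff hinj]
    simpa using hr
  have hset : {w : K | eval ![w] r = 0} = p.roots.toFinset := by
    ext w
    have := eval_eq_eval_mv_eval' (![] : Fin 0 → K) w r
    rw [Finset.mem_coe, Multiset.mem_toFinset, Polynomial.mem_roots hp0, Polynomial.IsRoot, hp,
      ← this]
    rfl
  rw [hset, Set.ncard_coe_finset]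
  refine ⟨Finset.finite_toSet _, (Multiset.toFinset_card_le _).trans ((p.card_roots').trans ?_)⟩
  exact Polynomial.natDegree_map_le.trans (natDegree_finSuccEquiv r).le

/-- Bézout's inequality, in terms of bidegrees, for the common zeros of two relatively prime
polynomials on the graph of an injective function. -/
theorem MvPolynomial.ncard_common_zeros_graph_le {K : Type*} [Field K] (φ : K → K)
    (hφ : Function.Injective φ)
    {F G : MvPolynomial (Fin 2) K} (hFG : IsRelPrime F G) (hF : F.degreeOf 0 ≠ 0) :
    {z : K | eval ![z, φ z] F = 0 ∧ eval ![z, φ z] G = 0}.ncard ≤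
      F.degreeOf 0 * G.degreeOf 1 + G.degreeOf 0 * F.degreeOf 1 := by
  set f := finSuccEquiv K 1 F with hf
  set g := finSuccEquiv K 1 G with hg
  have hf0 : f ≠ 0 := by simpa [hf] using ne_zero_of_degreeOf_ne_zero hF
  have hfg : IsRelPrime f g := by
    intro d hdf hdg
    have := @hFG ((finSuccEquiv K 1).symm d)
      (by simpa [hf] using map_dvd (finSuccEquiv K 1).symm hdf)
      (by simpa [hg] using map_dvd (finSuccEquiv K 1).symm hdg)
    simpa using this.map (finSuccEquiv K 1)
  have hr := Polynomial.resultant_ne_zero_of_isRelPrime hf0 hfg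
  obtain ⟨hfin, hcard⟩ := ncard_zeros_le_degreeOf hr
  have hdeg := degreeOf_resultant_le (0 : Fin 1) f g (m := f.natDegree) (n := g.natDegree)
    (fun k => degreeOf_coeff_finSuccEquiv F 0 k) (fun k => degreeOf_coeff_finSuccEquiv G 0 k)
  rw [hf, hg, natDegree_finSuccEquiv, natDegree_finSuccEquiv] at hdeg
  rw [hf, hg, natDegree_finSuccEquiv, natDegree_finSuccEquiv] at hcard hfin
  refine le_trans ?_ (hcard.trans hdeg)
  refine Set.ncard_le_ncard_of_injOn φ (fun z hz => ?_) hφ.injOn hfin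
  obtain ⟨p, q, -, -, hpq⟩ := Polynomial.exists_mul_add_mul_eq_C_resultant f g
    (natDegree_finSuccEquiv F).le (natDegree_finSuccEquiv G).le (Or.inl hF)
  have h := congrArg (fun P => Polynomial.eval z (P.map (eval ![φ z]))) hpq
  have hFz := (eval_eq_eval_mv_eval' ![φ z] z F).symm.trans hz.1
  have hGz := (eval_eq_eval_mv_eval' ![φ z] z G).symm.trans hz.2
  simp only [Polynomial.map_add, Polynomial.map_mul, Polynomial.eval_add, Polynomial.eval_mul,
    Polynomial.map_C, Polynomial.eval_C] at h
  rw [hf, hg, hFz, hGz] at h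
  simpa using h.symm

/-- The ring automorphism `F(z, w) ↦ F̄(w, z)` of `ℂ[z, w]`. -/
noncomputable def conjSwap : MvPolynomial (Fin 2) ℂ ≃+* MvPolynomial (Fin 2) ℂ :=
  (mapEquiv (Fin 2) (starRingAut : ℂ ≃+* ℂ)).trans
    (renameEquiv ℂ (Equiv.swap (0 : Fin 2) 1)).toRingEquiv

theorem conjSwap_apply (F : MvPolynomial (Fin 2) ℂ) :
    conjSwap F = rename (Equiv.swap (0 : Fin 2) 1) (map (starRingEnd ℂ) F) := rfl

theorem conjSwap_C (c : ℂ) : conjSwap (C c) = C (starRingEnd ℂ c) := by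
  simp [conjSwap_apply]

theorem conjSwap_conjSwap (F : MvPolynomial (Fin 2) ℂ) : conjSwap (conjSwap F) = F := by
  rw [conjSwap_apply, conjSwap_apply, map_rename, rename_rename, map_map]
  simp [← Equiv.coe_trans, map_id]

theorem eval_conjSwap (F : MvPolynomial (Fin 2) ℂ) (z : ℂ) :
    eval ![z, starRingEnd ℂ z] (conjSwap F) = starRingEnd ℂ (eval ![z, starRingEnd ℂ z] F) := by
  rw [conjSwap_apply, eval_rename, eval_map, eval, coe_eval₂Hom, hom_eval₂]
  congr 1
  funext i
  fin_cases i <;> simp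

theorem degreeOf_conjSwap (F : MvPolynomial (Fin 2) ℂ) (i : Fin 2) :
    (conjSwap F).degreeOf (Equiv.swap 0 1 i) = F.degreeOf i := by
  rw [conjSwap_apply, degreeOf_rename_of_injective (Equiv.injective _), degreeOf_eq_sup,
    degreeOf_eq_sup, support_map_of_injective _ (starRingEnd ℂ).injective]

theorem degreeOf_one_conjSwap (F : MvPolynomial (Fin 2) ℂ) :
    (conjSwap F).degreeOf 1 = F.degreeOf 0 := degreeOf_conjSwap F 0

theorem degreeOf_zero_conjSwap (F : MvPolynomial (Fin 2) ℂ) :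
    (conjSwap F).degreeOf 0 = F.degreeOf 1 := degreeOf_conjSwap F 1

theorem degreeOf_one_eq_of_conjSwap_eq {F : MvPolynomial (Fin 2) ℂ} (hF : conjSwap F = F) :
    F.degreeOf 1 = F.degreeOf 0 := by
  rw [← degreeOf_one_conjSwap F, hF]

theorem MvPolynomial.isUnit_of_degreeOf_eq_zero {σ K : Type*} [Field K] {F : MvPolynomial σ K}
    (hF : F ≠ 0) (h : ∀ i, F.degreeOf i = 0) : IsUnit F := by
  have hv : F.totalDegree = 0 := by
    rw [totalDegree_eq_zero_iff]
    intro m hm i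
    simpa [h i] using monomial_le_degreeOf i hm
  rw [totalDegree_eq_zero_iff_eq_C] at hv
  rw [hv] at hF ⊢
  exact (isUnit_iff_ne_zero.mpr fun h0 => hF (by rw [h0, C_0])).map C

theorem degreeOf_zero_ne_zero_of_conjSwap_eq {F : MvPolynomial (Fin 2) ℂ} (hF : conjSwap F = F)
    (h0 : F ≠ 0) (hu : ¬ IsUnit F) : F.degreeOf 0 ≠ 0 := by
  intro h
  refine hu (isUnit_of_degreeOf_eq_zero h0 fun i => ?_)
  fin_cases i
  · exact h
  · exact (degreeOf_one_eq_of_conjSwap_eq hF).trans h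

/-- The set of `z` with `F(z, z̄) = 0`. -/
def antidiagonalZeros (F : MvPolynomial (Fin 2) ℂ) : Set ℂ :=
  {z | eval ![z, starRingEnd ℂ z] F = 0}

theorem antidiagonalZeros_mul (F G : MvPolynomial (Fin 2) ℂ) :
    antidiagonalZeros (F * G) = antidiagonalZeros F ∪ antidiagonalZeros G := by
  ext z
  simp [antidiagonalZeros]

theorem antidiagonalZeros_conjSwap (F : MvPolynomial (Fin 2) ℂ) :
    antidiagonalZeros (conjSwap F) = antidiagonalZeros F := by
  ext z
  simp [antidiagonalZeros, eval_conjSwap]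

theorem antidiagonalZeros_of_isUnit {F : MvPolynomial (Fin 2) ℂ} (hF : IsUnit F) :
    antidiagonalZeros F = ∅ := by
  ext z
  simpa [antidiagonalZeros] using (hF.map (eval ![z, starRingEnd ℂ z])).ne_zero

theorem antidiagonalZeros_congr {F G : MvPolynomial (Fin 2) ℂ} (h : Associated F G) :
    antidiagonalZeros F = antidiagonalZeros G := by
  obtain ⟨u, rfl⟩ := h
  rw [antidiagonalZeros_mul, antidiagonalZeros_of_isUnit u.isUnit, Set.union_empty]

theorem ncard_antidiagonalZeros_inter_le {F G : MvPolynomial (Fin 2) ℂ} (hFG : IsRelPrime F G)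
    (hF : F.degreeOf 0 ≠ 0) :
    (antidiagonalZeros F ∩ antidiagonalZeros G).ncard ≤
      F.degreeOf 0 * G.degreeOf 1 + G.degreeOf 0 * F.degreeOf 1 :=
  ncard_common_zeros_graph_le (starRingEnd ℂ) (starRingEnd ℂ).injective hFG hF

theorem MvPolynomial.hasDerivAt_eval_line (p : MvPolynomial (Fin 2) ℂ) (z w a b : ℂ) :
    HasDerivAt (fun t : ℝ => eval ![z + t * a, w + t * b] p)
      (a * eval ![z, w] (pderiv 0 p) + b * eval ![z, w] (pderiv 1 p)) 0 := by
  have hlin : ∀ x c : ℂ, HasDerivAt (fun t : ℝ => x + t * c) c 0 := by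
    intro x c
    simpa using ((Complex.ofRealCLM.hasDerivAt (x := (0 : ℝ))).mul_const c).const_add x
  induction p using MvPolynomial.induction_on with
  | C r => simpa using hasDerivAt_const (0 : ℝ) r
  | add p q hp hq =>
    simp only [map_add]
    exact (hp.fun_add hq).congr_deriv (by ring)
  | mul_X p i hp =>
    simp only [map_mul, eval_X, Derivation.leibniz, smul_eq_mul, map_add, pderiv_X]
    fin_cases i
    · refine (hp.fun_mul (hlin z a)).congr_deriv ?_
      simp
      ring
    · refine (hp.fun_mul (hlin w b)).congr_deriv ?_
      simp
      ring

theorem IsPreconnected.forall_nonneg_or_forall_nonpos {X : Type*} [TopologicalSpace X] {f : X → ℝ}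
    (hf : Continuous f) (h : IsPreconnected {x | f x = 0}ᶜ) :
    (∀ x, 0 ≤ f x) ∨ ∀ x, f x ≤ 0 := by
  by_contra! hcon
  obtain ⟨⟨x, hx⟩, ⟨y, hy⟩⟩ := hcon
  obtain ⟨c, hc, hc0⟩ := h.intermediate_value (a := x) (b := y) hx.ne hy.ne' hf.continuousOn
    ⟨hx.le, hy.le⟩
  exact hc hc0

theorem mem_antidiagonalZeros_pderiv_of_finite {H : MvPolynomial (Fin 2) ℂ} (hH : conjSwap H = H)
    (hfin : (antidiagonalZeros H).Finite) {z : ℂ} (hz : z ∈ antidiagonalZeros H) :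
    z ∈ antidiagonalZeros (pderiv 0 H) := by
  have him : ∀ x : ℂ, (eval ![x, starRingEnd ℂ x] H).im = 0 := fun x => by
    rw [← Complex.conj_eq_iff_im, ← eval_conjSwap, hH]
  set f : ℂ → ℝ := fun x => (eval ![x, starRingEnd ℂ x] H).re with hf
  have hcont : Continuous f := by
    refine Complex.continuous_re.comp ?_
    refine (MvPolynomial.continuous_eval H).comp (continuous_pi fun i => ?_)
    fin_cases i
    · exact continuous_id
    · exact Complex.continuous_conj
  have hset : {x | f x = 0} = antidiagonalZeros H := by
    ext x
    simp [antidiagonalZeros, Complex.ext_iff, him, hf]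
  have hsign := IsPreconnected.forall_nonneg_or_forall_nonpos hcont (by
    rw [hset]
    exact (hfin.countable.isConnected_compl_of_one_lt_rank (by simp)).isPreconnected)
  have hz0 : f z = 0 := by rw [← hset] at hz; exact hz
  have hdir : ∀ a : ℂ, a * eval ![z, starRingEnd ℂ z] (pderiv 0 H) +
      starRingEnd ℂ a * eval ![z, starRingEnd ℂ z] (pderiv 1 H) = 0 := by
    intro a
    have hd := hasDerivAt_eval_line H z (starRingEnd ℂ z) a (starRingEnd ℂ a)
    have hline : ∀ t : ℝ, eval ![z + t * a, starRingEnd ℂ z + t * starRingEnd ℂ a] H =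
        eval ![z + t * a, starRingEnd ℂ (z + t * a)] H := fun t => by simp
    simp only [hline] at hd
    apply Complex.ext
    · have hre := Complex.reCLM.hasFDerivAt.comp_hasDerivAt (0 : ℝ) hd
      refine IsLocalExtr.hasDerivAt_eq_zero ?_ hre
      rcases hsign with h | h
      · refine Or.inl (Filter.Eventually.of_forall fun t => ?_)
        change f (z + (0 : ℝ) * a) ≤ f (z + t * a)
        simpa [hz0] using h (z + t * a)
      · refine Or.inr (Filter.Eventually.of_forall fun t => ?_)
        change f (z + t * a) ≤ f (z + (0 : ℝ) * a)
        simpa [hz0] using h (z + t * a)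
    · have hi := Complex.imCLM.hasFDerivAt.comp_hasDerivAt (0 : ℝ) hd
      refine hi.unique ((hasDerivAt_const (0 : ℝ) (0 : ℝ)).congr_of_eventuallyEq ?_)
      exact Filter.Eventually.of_forall fun t => him _
  have h1 := hdir 1
  have h2 := hdir Complex.I
  simp only [map_one, Complex.conj_I] at h1 h2
  have h3 : Complex.I * (2 * eval ![z, starRingEnd ℂ z] (pderiv 0 H)) = 0 := by
    linear_combination h2 + Complex.I * h1
  simpa [antidiagonalZeros] using h3

theorem MvPolynomial.degreeOf_pderiv_le {σ R : Type*} [CommSemiring R] (p : MvPolynomial σ R)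
    (i j : σ) : (pderiv i p).degreeOf j ≤ p.degreeOf j := by
  classical
  rw [degreeOf_le_iff]
  intro m hm
  rw [mem_support_iff, coeff_pderiv] at hm
  refine le_trans ?_ (monomial_le_degreeOf j (mem_support_iff.mpr (left_ne_zero_of_mul hm)))
  simp

theorem MvPolynomial.degreeOf_pderiv_self_lt {σ R : Type*} [CommSemiring R] {p : MvPolynomial σ R}
    {i : σ} (h : p.degreeOf i ≠ 0) : (pderiv i p).degreeOf i < p.degreeOf i := by
  classical
  rw [degreeOf_lt_iff (Nat.pos_of_ne_zero h)]
  intro m hm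
  rw [mem_support_iff, coeff_pderiv] at hm
  have := monomial_le_degreeOf i (mem_support_iff.mpr (left_ne_zero_of_mul hm))
  simpa using this

theorem MvPolynomial.pderiv_ne_zero {σ R : Type*} [CommRing R] [IsDomain R] [CharZero R]
    {p : MvPolynomial σ R} {i : σ} (h : p.degreeOf i ≠ 0) : pderiv i p ≠ 0 := by
  classical
  obtain ⟨m, hm, hmi⟩ : ∃ m ∈ p.support, m i ≠ 0 := by
    by_contra! hcon
    exact h (Nat.le_zero.mp (degreeOf_le_iff.mpr fun m hm => (hcon m hm).le))
  intro h0
  have hc := coeff_pderiv (i := i) p (m - Finsupp.single i 1)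
  rw [h0, coeff_zero, tsub_add_cancel_of_le (by simpa [Nat.one_le_iff_ne_zero] using hmi)] at hc
  exact mul_ne_zero (mem_support_iff.mp hm) (Nat.cast_add_one_ne_zero _) hc.symm

theorem MvPolynomial.degreeOf_le_of_dvd {σ R : Type*} [CommRing R] [IsDomain R]
    {p q : MvPolynomial σ R} (h : p ∣ q) (hq : q ≠ 0) (i : σ) : p.degreeOf i ≤ q.degreeOf i := by
  obtain ⟨r, rfl⟩ := h
  rw [degreeOf_mul_eq (left_ne_zero_of_mul hq) (right_ne_zero_of_mul hq)]
  exact Nat.le_add_right _ _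

theorem Irreducible.isRelPrime_pderiv {σ R : Type*} [CommRing R] [IsDomain R] [CharZero R]
    {p : MvPolynomial σ R} (hp : Irreducible p) {i : σ} (h : p.degreeOf i ≠ 0) :
    IsRelPrime p (pderiv i p) := by
  rw [hp.isRelPrime_iff_not_dvd]
  intro hdvd
  exact (degreeOf_pderiv_self_lt h).not_ge (degreeOf_le_of_dvd hdvd (pderiv_ne_zero h) i)

theorem ncard_antidiagonalZeros_le_of_irreducible {H : MvPolynomial (Fin 2) ℂ}
    (hH : conjSwap H = H) (hirr : Irreducible H) (hfin : (antidiagonalZeros H).Finite) :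
    (antidiagonalZeros H).ncard ≤ 2 * H.degreeOf 0 * H.degreeOf 0 := by
  have hd := degreeOf_zero_ne_zero_of_conjSwap_eq hH hirr.ne_zero hirr.not_isUnit
  have hb := ncard_antidiagonalZeros_inter_le (hirr.isRelPrime_pderiv hd) hd
  rw [Set.inter_eq_left.mpr fun z hz => mem_antidiagonalZeros_pderiv_of_finite hH hfin hz,
    degreeOf_one_eq_of_conjSwap_eq hH] at hb
  have h0 := degreeOf_pderiv_le H 0 0
  have h1 := degreeOf_pderiv_le H 0 1
  rw [degreeOf_one_eq_of_conjSwap_eq hH] at h1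
  nlinarith

theorem exists_associated_conjSwap_eq {L : MvPolynomial (Fin 2) ℂ}
    (h : Associated L (conjSwap L)) : ∃ M, Associated L M ∧ conjSwap M = M := by
  obtain ⟨u, hu⟩ := h
  obtain ⟨c, -, hc⟩ := MvPolynomial.isUnit_iff_eq_C_of_isReduced.mp u.isUnit
  by_cases hc1 : 1 + c = 0
  · have hL : conjSwap L = -L := by
      rw [← hu, hc, eq_neg_of_add_eq_zero_right hc1]
      simp
    refine ⟨L * C Complex.I, ?_, ?_⟩
    · exact associated_mul_unit_right _ _
        ((isUnit_iff_ne_zero.mpr Complex.I_ne_zero).map C)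
    · rw [map_mul, conjSwap_C, hL, Complex.conj_I, C_neg, neg_mul_neg]
  · refine ⟨L * C (1 + c), ?_, ?_⟩
    · exact associated_mul_unit_right _ _ ((isUnit_iff_ne_zero.mpr hc1).map C)
    · have : L * C (1 + c) = L + conjSwap L := by rw [← hu, hc, C_add, C_1]; ring
      rw [this, map_add, conjSwap_conjSwap, add_comm]

/-- A symmetric polynomial all of whose symmetric factorizations are trivial. -/
def IsSymmIrreducible (F : MvPolynomial (Fin 2) ℂ) : Prop :=
  ∀ A B, conjSwap A = A → conjSwap B = B → F = A * B → IsUnit A ∨ IsUnit B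

theorem IsSymmIrreducible.associated_of_dvd {F A : MvPolynomial (Fin 2) ℂ}
    (hirr : IsSymmIrreducible F) (hF : conjSwap F = F) (h0 : F ≠ 0) (hA : conjSwap A = A)
    (hu : ¬ IsUnit A) (hdvd : A ∣ F) : Associated A F := by
  obtain ⟨B, rfl⟩ := hdvd
  have hB : conjSwap B = B := by
    rw [map_mul, hA] at hF
    exact mul_left_cancel₀ (left_ne_zero_of_mul h0) hF
  exact associated_mul_unit_right _ _ ((hirr A B hA hB rfl).resolve_left hu)

theorem IsSymmIrreducible.ncard_inter_le {F G : MvPolynomial (Fin 2) ℂ}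
    (hFirr : IsSymmIrreducible F) (hGirr : IsSymmIrreducible G)
    (hF : conjSwap F = F) (hG : conjSwap G = G) (hF0 : F ≠ 0) (hG0 : G ≠ 0) (hFu : ¬ IsUnit F)
    (hfin : (antidiagonalZeros F ∩ antidiagonalZeros G).Finite) :
    (antidiagonalZeros F ∩ antidiagonalZeros G).ncard ≤ 2 * F.degreeOf 0 * G.degreeOf 0 := by
  by_cases hrel : IsRelPrime F G
  · have := ncard_antidiagonalZeros_inter_le hrel (degreeOf_zero_ne_zero_of_conjSwap_eq hF hF0 hFu)
    rw [degreeOf_one_eq_of_conjSwap_eq hF, degreeOf_one_eq_of_conjSwap_eq hG] at this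
    exact this.trans_eq (by ring)
  obtain ⟨L, hL, hLF, hLG⟩ : ∃ L, Irreducible L ∧ L ∣ F ∧ L ∣ G := by
    simp only [IsRelPrime, not_forall] at hrel
    obtain ⟨d, hdF, hdG, hd⟩ := hrel
    obtain ⟨L, hL, hLd⟩ := WfDvdMonoid.exists_irreducible_factor hd (ne_zero_of_dvd_ne_zero hF0 hdF)
    exact ⟨L, hL, hLd.trans hdF, hLd.trans hdG⟩
  -- A symmetric non-unit common divisor reduces the bound for `F` and `G` to one for itself.
  have hred : ∀ M, conjSwap M = M → ¬ IsUnit M → M ∣ F → M ∣ G →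
      ((antidiagonalZeros M).Finite →
        (antidiagonalZeros M).ncard ≤ 2 * M.degreeOf 0 * M.degreeOf 0) →
      (antidiagonalZeros F ∩ antidiagonalZeros G).ncard ≤ 2 * F.degreeOf 0 * G.degreeOf 0 := by
    intro M hM hMu hMF hMG hb
    have hF' := hFirr.associated_of_dvd hF hF0 hM hMu hMF
    have hG' := hGirr.associated_of_dvd hG hG0 hM hMu hMG
    rw [← antidiagonalZeros_congr hF', ← antidiagonalZeros_congr hG', Set.inter_self] at hfin ⊢
    refine (hb hfin).trans ?_
    have h1 := degreeOf_le_of_dvd hMF hF0 0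
    have h2 := degreeOf_le_of_dvd hMG hG0 0
    gcongr
  by_cases hass : Associated L (conjSwap L)
  · obtain ⟨M, hLM, hM⟩ := exists_associated_conjSwap_eq hass
    have hMirr := hLM.irreducible hL
    exact hred M hM hMirr.not_isUnit (hLM.symm.dvd.trans hLF) (hLM.symm.dvd.trans hLG)
      (ncard_antidiagonalZeros_le_of_irreducible hM hMirr)
  · have hL' : Irreducible (conjSwap L) := (MulEquiv.irreducible_iff conjSwap).mpr hL
    have hrel' : IsRelPrime L (conjSwap L) := by
      rw [hL.isRelPrime_iff_not_dvd]
      exact fun h => hass (hL.associated_of_dvd hL' h)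
    have hdvd : ∀ P, conjSwap P = P → L ∣ P → L * conjSwap L ∣ P := fun P hP h =>
      hrel'.mul_dvd h (by simpa [hP] using map_dvd conjSwap h)
    refine hred (L * conjSwap L) ?_ (fun h => hL.not_isUnit (isUnit_of_mul_isUnit_left h))
      (hdvd F hF hLF) (hdvd G hG hLG) fun _ => ?_
    · rw [map_mul, conjSwap_conjSwap, mul_comm]
    · have hz : antidiagonalZeros (L * conjSwap L) =
          antidiagonalZeros L ∩ antidiagonalZeros (conjSwap L) := by
        rw [antidiagonalZeros_mul, antidiagonalZeros_conjSwap, Set.union_self, Set.inter_self]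
      have hz' : antidiagonalZeros (L * conjSwap L) =
          antidiagonalZeros (conjSwap L) ∩ antidiagonalZeros L := by rw [hz, Set.inter_comm]
      rw [degreeOf_mul_eq hL.ne_zero hL'.ne_zero, degreeOf_zero_conjSwap]
      by_cases h0 : L.degreeOf 0 = 0
      · have h1 : (conjSwap L).degreeOf 0 ≠ 0 := fun h1 => hL.not_isUnit <|
          isUnit_of_degreeOf_eq_zero hL.ne_zero fun i => by
            fin_cases i
            · exact h0
            · rwa [degreeOf_zero_conjSwap] at h1
        have := ncard_antidiagonalZeros_inter_le hrel'.symm h1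
        rw [degreeOf_zero_conjSwap, degreeOf_one_conjSwap] at this
        rw [hz']
        nlinarith
      · have := ncard_antidiagonalZeros_inter_le hrel' h0
        rw [degreeOf_zero_conjSwap, degreeOf_one_conjSwap] at this
        rw [hz]
        nlinarith

theorem ncard_antidiagonalZeros_mul_inter_le {A B G : MvPolynomial (Fin 2) ℂ}
    (hA0 : A ≠ 0) (hB0 : B ≠ 0)
    (hA : (antidiagonalZeros A ∩ antidiagonalZeros G).ncard ≤ 2 * A.degreeOf 0 * G.degreeOf 0)
    (hB : (antidiagonalZeros B ∩ antidiagonalZeros G).ncard ≤ 2 * B.degreeOf 0 * G.degreeOf 0) :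
    (antidiagonalZeros (A * B) ∩ antidiagonalZeros G).ncard ≤
      2 * (A * B).degreeOf 0 * G.degreeOf 0 := by
  rw [antidiagonalZeros_mul, Set.union_inter_distrib_right, degreeOf_mul_eq hA0 hB0]
  refine (Set.ncard_union_le _ _).trans ((add_le_add hA hB).trans_eq (by ring))

theorem ncard_antidiagonalZeros_inter_le_of_conjSwap_eq {F G : MvPolynomial (Fin 2) ℂ}
    (hF : conjSwap F = F) (hG : conjSwap G = G) (hF0 : F ≠ 0) (hG0 : G ≠ 0)
    (hfin : (antidiagonalZeros F ∩ antidiagonalZeros G).Finite) :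
    (antidiagonalZeros F ∩ antidiagonalZeros G).ncard ≤ 2 * F.degreeOf 0 * G.degreeOf 0 := by
  induction hk : F.degreeOf 0 + G.degreeOf 0 using Nat.strong_induction_on generalizing F G with
  | _ k ih =>
  subst hk
  by_cases hFu : IsUnit F
  · simp [antidiagonalZeros_of_isUnit hFu]
  -- It suffices to treat pairs whose first member has no proper symmetric factorization.
  have hsplit : ∀ P Q, conjSwap P = P → conjSwap Q = Q → P ≠ 0 → Q ≠ 0 →
      (antidiagonalZeros P ∩ antidiagonalZeros Q).Finite →
      P.degreeOf 0 + Q.degreeOf 0 = F.degreeOf 0 + G.degreeOf 0 → ¬ IsSymmIrreducible P →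
      (antidiagonalZeros P ∩ antidiagonalZeros Q).ncard ≤ 2 * P.degreeOf 0 * Q.degreeOf 0 := by
    intro P Q hP hQ hP0 hQ0 hPQ hdeg hirr
    simp only [IsSymmIrreducible, not_forall, not_or] at hirr
    obtain ⟨A, B, hA, hB, rfl, hAu, hBu⟩ := hirr
    have hA0 := left_ne_zero_of_mul hP0
    have hB0 := right_ne_zero_of_mul hP0
    have hAd := degreeOf_zero_ne_zero_of_conjSwap_eq hA hA0 hAu
    have hBd := degreeOf_zero_ne_zero_of_conjSwap_eq hB hB0 hBu
    rw [degreeOf_mul_eq hA0 hB0] at hdeg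
    rw [antidiagonalZeros_mul, Set.union_inter_distrib_right, Set.finite_union] at hPQ
    exact ncard_antidiagonalZeros_mul_inter_le hA0 hB0
      (ih _ (by omega) hA hQ hA0 hQ0 hPQ.1 rfl) (ih _ (by omega) hB hQ hB0 hQ0 hPQ.2 rfl)
  by_cases hFirr : IsSymmIrreducible F
  · by_cases hGirr : IsSymmIrreducible G
    · exact hFirr.ncard_inter_le hGirr hF hG hF0 hG0 hFu hfin
    · rw [Set.inter_comm] at hfin ⊢
      exact (hsplit G F hG hF hG0 hF0 hfin (add_comm _ _) hGirr).trans_eq (by ring)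
  · exact hsplit F G hF hG hF0 hG0 hfin rfl hFirr

theorem real_bezout_conjugation_symmetric (F G : MvPolynomial (Fin 2) ℂ)
    (hF : F ≠ 0) (hG : G ≠ 0)
    (hFsym : MvPolynomial.rename (Equiv.swap (0 : Fin 2) 1)
      (MvPolynomial.map (starRingEnd ℂ) F) = F)
    (hGsym : MvPolynomial.rename (Equiv.swap (0 : Fin 2) 1)
      (MvPolynomial.map (starRingEnd ℂ) G) = G)
    (m n : ℕ) (hm : F.degreeOf 0 = m) (hn : G.degreeOf 0 = n) :
    {z : ℂ | MvPolynomial.eval ![z, starRingEnd ℂ z] F = 0 ∧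
      MvPolynomial.eval ![z, starRingEnd ℂ z] G = 0}.Infinite ∨
    {z : ℂ | MvPolynomial.eval ![z, starRingEnd ℂ z] F = 0 ∧
      MvPolynomial.eval ![z, starRingEnd ℂ z] G = 0}.ncard ≤ 2 * m * n := by
  subst hm hn
  rw [or_iff_not_imp_left, Set.not_infinite]
  exact ncard_antidiagonalZeros_inter_le_of_conjSwap_eq hFsym hGsym hF hG
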